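/- arXiv:2308.08471 — 9 statements merged into one kernel-verified Lean document; each statement's English description precedes it below -/
import Mathlib

section
/- Suppose there exist scalars μ ≥ 0 and λ ≥ 0, a symmetric positive semidefinite matrix P_Δ ∈ ℝ^{n_ψ×n_ψ}, and a continuously differentiable function V : ℝⁿ → ℝ with V(0) = 0 and V(x) > 0 for x ≠ 0, such that for all ψ ∈ ℝ^{n_ψ}, x ∈ ℝⁿ, v ∈ ℝᵐ, ξ ∈ ℝˡ, w ∈ ℝᵖ: ∇V(x)ᵀ f(x,v,w,ξ) + 2 ψᵀ P_Δ (A_Ψ ψ + B_Ψ (x,v,ξ)) ≤ s(w, h(x,v)) + λ ‖g(x,v,w,ξ)‖² + μ (C_Ψ ψ + D_Ψ (x,v,ξ))ᵀ M (C_Ψ ψ + D_Ψ (x,v,ξ)). Then for every trajectory (x,v,w,ξ) of the DAE on [0,T] together with a filter trajectory ψ (with ψ(0)=0) whose output z satisfies the hard IQC defined by (Ψ,M), it holds that V(x(T)) − V(x(0)) ≤ ∫₀ᵀ s(w(t), h(x(t),v(t))) dt. -/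
open Matrix MeasureTheory

theorem hasDerivAt_dot_aux {k : ℕ} {a b : ℝ → Fin k → ℝ} {a' b' : Fin k → ℝ} {t : ℝ}
    (ha : HasDerivAt a a' t) (hb : HasDerivAt b b' t) :
    HasDerivAt (fun t => a t ⬝ᵥ b t) (a' ⬝ᵥ b t + a t ⬝ᵥ b') t := by
  have := HasDerivAt.fun_sum (u := Finset.univ) (fun i _ =>
    ((hasDerivAt_pi.1 ha) i).fun_mul ((hasDerivAt_pi.1 hb) i))
  simpa [dotProduct, Finset.sum_add_distrib] using this

theorem hasDerivAt_mulVec_aux {j k : ℕ} (A : Matrix (Fin j) (Fin k) ℝ)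
    {a : ℝ → Fin k → ℝ} {a' : Fin k → ℝ} {t : ℝ}
    (ha : HasDerivAt a a' t) : HasDerivAt (fun t => A *ᵥ a t) (A *ᵥ a') t := by
  rw [hasDerivAt_pi]
  intro i
  have := hasDerivAt_dot_aux (hasDerivAt_const t (A i)) ha
  simpa [mulVec] using this

theorem continuous_append_aux {j k : ℕ} :
    Continuous fun u : (Fin j → ℝ) × (Fin k → ℝ) => Fin.append u.1 u.2 := by
  refine continuous_pi fun i => ?_
  refine Fin.addCases (fun i => ?_) (fun i => ?_) i
  · simp only [Fin.append_left]; fun_prop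
  · simp only [Fin.append_right]; fun_prop

/-- Theorem 1 of the paper: a dissipation inequality certificate implies dissipativity of an
uncertain DAE system whose uncertainty satisfies a hard IQC defined by `(Ψ, M)`. -/
theorem dae_dissipativity_of_certificate
    {n m p l r q nψ nz : ℕ}
    (f : (Fin n → ℝ) → (Fin m → ℝ) → (Fin p → ℝ) → (Fin l → ℝ) → (Fin n → ℝ))
    (g : (Fin n → ℝ) → (Fin m → ℝ) → (Fin p → ℝ) → (Fin l → ℝ) → (Fin r → ℝ))
    (h : (Fin n → ℝ) → (Fin m → ℝ) → (Fin q → ℝ))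
    (s : (Fin p → ℝ) → (Fin q → ℝ) → ℝ)
    (hf : Continuous fun u : ((Fin n → ℝ) × (Fin m → ℝ) × (Fin p → ℝ) × (Fin l → ℝ)) =>
      f u.1 u.2.1 u.2.2.1 u.2.2.2)
    (hg : Continuous fun u : ((Fin n → ℝ) × (Fin m → ℝ) × (Fin p → ℝ) × (Fin l → ℝ)) =>
      g u.1 u.2.1 u.2.2.1 u.2.2.2)
    (hh : Continuous fun u : ((Fin n → ℝ) × (Fin m → ℝ)) => h u.1 u.2)
    (hs : Continuous fun u : ((Fin p → ℝ) × (Fin q → ℝ)) => s u.1 u.2)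
    (AΨ : Matrix (Fin nψ) (Fin nψ) ℝ) (BΨ : Matrix (Fin nψ) (Fin (n + m + l)) ℝ)
    (CΨ : Matrix (Fin nz) (Fin nψ) ℝ) (DΨ : Matrix (Fin nz) (Fin (n + m + l)) ℝ)
    (M : Matrix (Fin nz) (Fin nz) ℝ) (hM : M.IsSymm)
    (μ lam : ℝ) (hμ : 0 ≤ μ) (hlam : 0 ≤ lam)
    (PΔ : Matrix (Fin nψ) (Fin nψ) ℝ) (hPΔ : PΔ.PosSemidef)
    (V : (Fin n → ℝ) → ℝ) (hV : ContDiff ℝ 1 V) (hV0 : V 0 = 0)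
    (hVpos : ∀ x : Fin n → ℝ, x ≠ 0 → 0 < V x)
    (hcert : ∀ (ψ : Fin nψ → ℝ) (x : Fin n → ℝ) (v : Fin m → ℝ) (ξ : Fin l → ℝ)
        (w : Fin p → ℝ),
      fderiv ℝ V x (f x v w ξ)
          + 2 * (ψ ⬝ᵥ PΔ *ᵥ (AΨ *ᵥ ψ + BΨ *ᵥ Fin.append (Fin.append x v) ξ))
        ≤ s w (h x v) + lam * (g x v w ξ ⬝ᵥ g x v w ξ)
          + μ * ((CΨ *ᵥ ψ + DΨ *ᵥ Fin.append (Fin.append x v) ξ) ⬝ᵥ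
              M *ᵥ (CΨ *ᵥ ψ + DΨ *ᵥ Fin.append (Fin.append x v) ξ)))
    (T : ℝ) (hT : 0 ≤ T)
    (x : ℝ → Fin n → ℝ) (v : ℝ → Fin m → ℝ) (w : ℝ → Fin p → ℝ) (ξ : ℝ → Fin l → ℝ)
    (ψ : ℝ → Fin nψ → ℝ)
    (hv : ContinuousOn v (Set.Icc 0 T)) (hw : ContinuousOn w (Set.Icc 0 T))
    (hξ : ContinuousOn ξ (Set.Icc 0 T))
    (hx : ∀ t ∈ Set.Icc (0 : ℝ) T, HasDerivAt x (f (x t) (v t) (w t) (ξ t)) t)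
    (halg : ∀ t ∈ Set.Icc (0 : ℝ) T, g (x t) (v t) (w t) (ξ t) = 0)
    (hψ0 : ψ 0 = 0)
    (hψ : ∀ t ∈ Set.Icc (0 : ℝ) T,
      HasDerivAt ψ (AΨ *ᵥ ψ t + BΨ *ᵥ Fin.append (Fin.append (x t) (v t)) (ξ t)) t)
    (hIQC : ∀ T' ∈ Set.Icc (0 : ℝ) T,
      (∫ t in (0 : ℝ)..T',
        (CΨ *ᵥ ψ t + DΨ *ᵥ Fin.append (Fin.append (x t) (v t)) (ξ t)) ⬝ᵥ
          M *ᵥ (CΨ *ᵥ ψ t + DΨ *ᵥ Fin.append (Fin.append (x t) (v t)) (ξ t))) ≤ 0) :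
    V (x T) - V (x 0) ≤ ∫ t in (0 : ℝ)..T, s (w t) (h (x t) (v t)) := by
  have hxc : ContinuousOn x (Set.Icc 0 T) := fun t ht => (hx t ht).continuousAt.continuousWithinAt
  have hψc : ContinuousOn ψ (Set.Icc 0 T) := fun t ht => (hψ t ht).continuousAt.continuousWithinAt
  have huc : ContinuousOn (fun t => Fin.append (Fin.append (x t) (v t)) (ξ t)) (Set.Icc 0 T) :=
    continuous_append_aux.comp_continuousOn
      ((continuous_append_aux.comp_continuousOn (hxc.prodMk hv)).prodMk hξ)
  have hsc : ContinuousOn (fun t => s (w t) (h (x t) (v t))) (Set.Icc 0 T) :=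
    hs.comp_continuousOn (hw.prodMk (hh.comp_continuousOn (hxc.prodMk hv)))
  have hzq : Continuous fun u : (Fin nψ → ℝ) × (Fin (n + m + l) → ℝ) =>
      (CΨ *ᵥ u.1 + DΨ *ᵥ u.2) ⬝ᵥ M *ᵥ (CΨ *ᵥ u.1 + DΨ *ᵥ u.2) := by
    have h1 : Continuous fun u : (Fin nψ → ℝ) × (Fin (n + m + l) → ℝ) =>
      (CΨ *ᵥ u.1 + DΨ *ᵥ u.2) :=
      (continuous_const.matrix_mulVec continuous_fst).add
        (continuous_const.matrix_mulVec continuous_snd)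
    exact h1.dotProduct (continuous_const.matrix_mulVec h1)
  have hzc := hzq.comp_continuousOn (hψc.prodMk huc)
  have hWd : ∀ t ∈ Set.Icc (0 : ℝ) T, HasDerivAt (fun t => V (x t) + ψ t ⬝ᵥ PΔ *ᵥ ψ t)
      (fderiv ℝ V (x t) (f (x t) (v t) (w t) (ξ t)) + 2 * (ψ t ⬝ᵥ PΔ *ᵥ
        (AΨ *ᵥ ψ t + BΨ *ᵥ Fin.append (Fin.append (x t) (v t)) (ξ t)))) t := by
    intro t ht
    have h1 := ((hV.differentiable one_ne_zero (x t)).hasFDerivAt).comp_hasDerivAt t (hx t ht)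
    have h2 := hasDerivAt_dot_aux (hψ t ht) (hasDerivAt_mulVec_aux PΔ (hψ t ht))
    refine (h1.add h2).congr_deriv ?_
    have hsym : PΔᵀ = PΔ := by simpa [Matrix.IsHermitian] using hPΔ.1
    generalize AΨ *ᵥ ψ t + BΨ *ᵥ Fin.append (Fin.append (x t) (v t)) (ξ t) = y
    have : y ⬝ᵥ PΔ *ᵥ ψ t = ψ t ⬝ᵥ PΔ *ᵥ y := by
      rw [dotProduct_mulVec, dotProduct_comm, ← mulVec_transpose, hsym]
    rw [this]; ring
  have key := intervalIntegral.sub_le_integral_of_hasDeriv_right_of_le hT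
    (fun t ht => (hWd t ht).continuousAt.continuousWithinAt)
    (fun t ht => (hWd t (Set.Ioo_subset_Icc_self ht)).hasDerivWithinAt)
    ((hsc.add (hzc.const_smul μ)).integrableOn_Icc)
    (fun t ht => by
      have := hcert (ψ t) (x t) (v t) (ξ t) (w t)
      rw [halg t (Set.Ioo_subset_Icc_self ht)] at this
      simpa using this)
  have hi := hIQC T ⟨hT, le_rfl⟩
  have e : ∫ t in (0 : ℝ)..T, (s (w t) (h (x t) (v t)) + μ *
      ((CΨ *ᵥ ψ t + DΨ *ᵥ Fin.append (Fin.append (x t) (v t)) (ξ t)) ⬝ᵥ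
          M *ᵥ (CΨ *ᵥ ψ t + DΨ *ᵥ Fin.append (Fin.append (x t) (v t)) (ξ t)))) =
      (∫ t in (0 : ℝ)..T, s (w t) (h (x t) (v t))) + μ * ∫ t in (0 : ℝ)..T,
      ((CΨ *ᵥ ψ t + DΨ *ᵥ Fin.append (Fin.append (x t) (v t)) (ξ t)) ⬝ᵥ
          M *ᵥ (CΨ *ᵥ ψ t + DΨ *ᵥ Fin.append (Fin.append (x t) (v t)) (ξ t))) := by
    rw [intervalIntegral.integral_add, intervalIntegral.integral_const_mul]
    · exact hsc.intervalIntegrable_of_Icc hT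
    · exact (hzc.const_smul μ).intervalIntegrable_of_Icc hT
  have key2 := key.trans_eq e
  have hP : 0 ≤ ψ T ⬝ᵥ PΔ *ᵥ ψ T := by simpa using hPΔ.dotProduct_mulVec_nonneg (ψ T)
  have hm := mul_nonpos_of_nonneg_of_nonpos hμ hi
  have h0 : ψ 0 ⬝ᵥ PΔ *ᵥ ψ 0 = 0 := by simp [hψ0]
  simp only [h0] at key2
  linarith
end

section
/- Suppose there exist scalars μ ≥ 0 and λ ≥ 0, a symmetric positive semidefinite matrix P_Δ ∈ ℝ^{n_ψ×n_ψ}, and a continuously differentiable function V : ℝⁿ → ℝ with V(0) = 0 and V(x) > 0 for x ≠ 0, such that for all ψ, x, v, ξ, w: ∇V(x)ᵀ f(x,v,w,ξ) + 2 ψᵀ P_Δ (A_Ψ ψ + B_Ψ (x,v,ξ)) ≤ s(w, h(x,v)) + λ ‖g(x,v,w,ξ)‖² + μ (C_Ψ ψ + D_Ψ (x,v,ξ))ᵀ M (C_Ψ ψ + D_Ψ (x,v,ξ)). Then for every trajectory (x,v,w,ξ) of the DAE on [0,T] together with a filter trajectory ψ (with ψ(0)=0) whose output z satisfies the hard IQC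 defined by (Ψ,M), the stronger inequality V(x(T)) + ψ(T)ᵀ P_Δ ψ(T) − V(x(0)) ≤ ∫₀ᵀ s(w(t), h(x(t),v(t))) dt holds; in particular the augmented function Ṽ(x,ψ) = V(x) + ψᵀ P_Δ ψ is a storage function for the augmented system of DAE and filter. -/
open Matrix MeasureTheory

lemma aux_quad_deriv {k : ℕ} (P : Matrix (Fin k) (Fin k) ℝ) (hP : P.PosSemidef)
    (ψ : ℝ → Fin k → ℝ) (d : Fin k → ℝ) (t : ℝ) (hd : HasDerivAt ψ d t) :
    HasDerivAt (fun t => ψ t ⬝ᵥ P *ᵥ ψ t) (2 * (ψ t ⬝ᵥ P *ᵥ d)) t := by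
  have hsym : Pᵀ = P := by
    have := hP.isHermitian.eq
    rwa [conjTranspose_eq_transpose_of_trivial] at this
  have hc := hasDerivAt_pi.1 hd
  have h1 : HasDerivAt (fun t => ψ t ⬝ᵥ P *ᵥ ψ t)
      (d ⬝ᵥ P *ᵥ ψ t + ψ t ⬝ᵥ P *ᵥ d) t := by
    simp only [dotProduct, mulVec, ← Finset.sum_add_distrib]
    refine HasDerivAt.fun_sum fun i _ => ?_
    refine (hc i).mul ?_
    exact HasDerivAt.fun_sum fun j _ => (hc j).const_mul (P i j)
  convert h1 using 1
  have : d ⬝ᵥ P *ᵥ ψ t = ψ t ⬝ᵥ P *ᵥ d := by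
    rw [dotProduct_mulVec, ← mulVec_transpose, hsym, dotProduct_comm]
  rw [this]; ring

lemma aux_append_cont {a b : ℕ} {S : Set ℝ} (u : ℝ → Fin a → ℝ) (v : ℝ → Fin b → ℝ)
    (hu : ContinuousOn u S) (hv : ContinuousOn v S) :
    ContinuousOn (fun t => Fin.append (u t) (v t)) S := by
  rw [continuousOn_pi] at *
  intro i
  refine Fin.addCases (fun j => ?_) (fun j => ?_) i
  · simpa using hu j
  · simpa using hv j

/-- Theorem 1 of the paper: a dissipation inequality certificate implies dissipativity of an
uncertain DAE system whose uncertainty satisfies a hard IQC defined by `(Ψ, M)`. -/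
theorem dae_augmented_storage_of_certificate
    {n m p l r q nψ nz : ℕ}
    (f : (Fin n → ℝ) → (Fin m → ℝ) → (Fin p → ℝ) → (Fin l → ℝ) → (Fin n → ℝ))
    (g : (Fin n → ℝ) → (Fin m → ℝ) → (Fin p → ℝ) → (Fin l → ℝ) → (Fin r → ℝ))
    (h : (Fin n → ℝ) → (Fin m → ℝ) → (Fin q → ℝ))
    (s : (Fin p → ℝ) → (Fin q → ℝ) → ℝ)
    (hf : Continuous fun u : ((Fin n → ℝ) × (Fin m → ℝ) × (Fin p → ℝ) × (Fin l → ℝ)) =>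
      f u.1 u.2.1 u.2.2.1 u.2.2.2)
    (hg : Continuous fun u : ((Fin n → ℝ) × (Fin m → ℝ) × (Fin p → ℝ) × (Fin l → ℝ)) =>
      g u.1 u.2.1 u.2.2.1 u.2.2.2)
    (hh : Continuous fun u : ((Fin n → ℝ) × (Fin m → ℝ)) => h u.1 u.2)
    (hs : Continuous fun u : ((Fin p → ℝ) × (Fin q → ℝ)) => s u.1 u.2)
    (AΨ : Matrix (Fin nψ) (Fin nψ) ℝ) (BΨ : Matrix (Fin nψ) (Fin (n + m + l)) ℝ)
    (CΨ : Matrix (Fin nz) (Fin nψ) ℝ) (DΨ : Matrix (Fin nz) (Fin (n + m + l)) ℝ)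
    (M : Matrix (Fin nz) (Fin nz) ℝ) (hM : M.IsSymm)
    (μ lam : ℝ) (hμ : 0 ≤ μ) (hlam : 0 ≤ lam)
    (PΔ : Matrix (Fin nψ) (Fin nψ) ℝ) (hPΔ : PΔ.PosSemidef)
    (V : (Fin n → ℝ) → ℝ) (hV : ContDiff ℝ 1 V) (hV0 : V 0 = 0)
    (hVpos : ∀ x : Fin n → ℝ, x ≠ 0 → 0 < V x)
    (hcert : ∀ (ψ : Fin nψ → ℝ) (x : Fin n → ℝ) (v : Fin m → ℝ) (ξ : Fin l → ℝ)
        (w : Fin p → ℝ),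
      fderiv ℝ V x (f x v w ξ)
          + 2 * (ψ ⬝ᵥ PΔ *ᵥ (AΨ *ᵥ ψ + BΨ *ᵥ Fin.append (Fin.append x v) ξ))
        ≤ s w (h x v) + lam * (g x v w ξ ⬝ᵥ g x v w ξ)
          + μ * ((CΨ *ᵥ ψ + DΨ *ᵥ Fin.append (Fin.append x v) ξ) ⬝ᵥ
              M *ᵥ (CΨ *ᵥ ψ + DΨ *ᵥ Fin.append (Fin.append x v) ξ)))
    (T : ℝ) (hT : 0 ≤ T)
    (x : ℝ → Fin n → ℝ) (v : ℝ → Fin m → ℝ) (w : ℝ → Fin p → ℝ) (ξ : ℝ → Fin l → ℝ)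
    (ψ : ℝ → Fin nψ → ℝ)
    (hv : ContinuousOn v (Set.Icc 0 T)) (hw : ContinuousOn w (Set.Icc 0 T))
    (hξ : ContinuousOn ξ (Set.Icc 0 T))
    (hx : ∀ t ∈ Set.Icc (0 : ℝ) T, HasDerivAt x (f (x t) (v t) (w t) (ξ t)) t)
    (halg : ∀ t ∈ Set.Icc (0 : ℝ) T, g (x t) (v t) (w t) (ξ t) = 0)
    (hψ0 : ψ 0 = 0)
    (hψ : ∀ t ∈ Set.Icc (0 : ℝ) T,
      HasDerivAt ψ (AΨ *ᵥ ψ t + BΨ *ᵥ Fin.append (Fin.append (x t) (v t)) (ξ t)) t)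
    (hIQC : ∀ T' ∈ Set.Icc (0 : ℝ) T,
      (∫ t in (0 : ℝ)..T',
        (CΨ *ᵥ ψ t + DΨ *ᵥ Fin.append (Fin.append (x t) (v t)) (ξ t)) ⬝ᵥ
          M *ᵥ (CΨ *ᵥ ψ t + DΨ *ᵥ Fin.append (Fin.append (x t) (v t)) (ξ t))) ≤ 0) :
    V (x T) + ψ T ⬝ᵥ PΔ *ᵥ ψ T - V (x 0) ≤ ∫ t in (0 : ℝ)..T, s (w t) (h (x t) (v t)) := by
  have hxc : ContinuousOn x (Set.Icc 0 T) := fun t ht => (hx t ht).continuousAt.continuousWithinAt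
  have hψc : ContinuousOn ψ (Set.Icc 0 T) := fun t ht => (hψ t ht).continuousAt.continuousWithinAt
  have hac := aux_append_cont _ _ (aux_append_cont _ _ hxc hv) hξ
  have hzc : ContinuousOn (fun t => CΨ *ᵥ ψ t + DΨ *ᵥ Fin.append (Fin.append (x t) (v t)) (ξ t))
      (Set.Icc 0 T) := by
    have h1 : Continuous fun y => CΨ *ᵥ y := by fun_prop
    have h2 : Continuous fun y => DΨ *ᵥ y := by fun_prop
    exact (h1.comp_continuousOn hψc).add (h2.comp_continuousOn hac)
  have hqc : ContinuousOn (fun t =>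
      (CΨ *ᵥ ψ t + DΨ *ᵥ Fin.append (Fin.append (x t) (v t)) (ξ t)) ⬝ᵥ
          M *ᵥ (CΨ *ᵥ ψ t + DΨ *ᵥ Fin.append (Fin.append (x t) (v t)) (ξ t))) (Set.Icc 0 T) := by
    have h1 : Continuous fun y : Fin nz → ℝ => y ⬝ᵥ M *ᵥ y := by fun_prop
    exact h1.comp_continuousOn hzc
  have hsc : ContinuousOn (fun t => s (w t) (h (x t) (v t))) (Set.Icc 0 T) :=
    hs.comp_continuousOn (hw.prodMk (hh.comp_continuousOn (hxc.prodMk hv)))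
  have hd : ∀ t ∈ Set.Icc 0 T, HasDerivAt (fun t => V (x t) + ψ t ⬝ᵥ PΔ *ᵥ ψ t)
      (fderiv ℝ V (x t) (f (x t) (v t) (w t) (ξ t)) + 2 * (ψ t ⬝ᵥ PΔ *ᵥ
        (AΨ *ᵥ ψ t + BΨ *ᵥ Fin.append (Fin.append (x t) (v t)) (ξ t)))) t := by
    intro t ht
    have hVd : HasFDerivAt V (fderiv ℝ V (x t)) (x t) :=
      (hV.differentiable one_ne_zero (x t)).hasFDerivAt
    exact (hVd.comp_hasDerivAt t (hx t ht)).add (aux_quad_deriv PΔ hPΔ ψ _ t (hψ t ht))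
  have key := intervalIntegral.sub_le_integral_of_hasDeriv_right_of_le hT
    (fun t ht => (hd t ht).continuousAt.continuousWithinAt)
    (fun t ht => (hd t (Set.Ioo_subset_Icc_self ht)).hasDerivWithinAt)
    (ContinuousOn.integrableOn_Icc (hsc.add (hqc.const_smul μ)))
    (fun t ht => by
      have := hcert (ψ t) (x t) (v t) (ξ t) (w t)
      rw [halg t (Set.Ioo_subset_Icc_self ht)] at this
      simpa using this)
  have hI := hIQC T ⟨hT, le_rfl⟩
  simp only [Pi.add_apply, Pi.smul_apply] at key
  rw [intervalIntegral.integral_add (hsc.intervalIntegrable_of_Icc hT)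
    ((hqc.fun_const_smul μ).intervalIntegrable_of_Icc hT), intervalIntegral.integral_smul,
    smul_eq_mul] at key
  simp only [hψ0, zero_dotProduct, add_zero] at key
  have := mul_nonpos_of_nonneg_of_nonpos hμ hI
  linarith
end

section
/- (Stability via zero supply rate.) Suppose there exist scalars μ ≥ 0 and λ ≥ 0, a symmetric positive semidefinite matrix P_Δ, and a continuously differentiable function V : ℝⁿ → ℝ with V(0) = 0 and V(x) > 0 for x ≠ 0, such that for all ψ, x, v, ξ, w: ∇V(x)ᵀ f(x,v,w,ξ) + 2 ψᵀ P_Δ (A_Ψ ψ + B_Ψ (x,v,ξ)) ≤ λ ‖g(x,v,w,ξ)‖² + μ (C_Ψ ψ + D_Ψ (x,v,ξ))ᵀ M (C_Ψ ψ + D_Ψ (x,v,ξ)). Then along every trajectory of the DAE on [0,T] with associated filter trajectory whose output satisfies the hard IQC defined by (Ψ,M), the positive definite function V is nonincreasing: V(x(T')) ≤ V(x(0)) for every T' ∈ [0,T]; i.e., V serves as a Lyapunov function certifying stability of the origin. -/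
open Matrix MeasureTheory

theorem aux_append {a b : ℕ} {s : Set ℝ} {x : ℝ → Fin a → ℝ} {y : ℝ → Fin b → ℝ}
    (hx : ContinuousOn x s) (hy : ContinuousOn y s) :
    ContinuousOn (fun t => Fin.append (x t) (y t)) s := by
  rw [continuousOn_pi] at hx hy ⊢
  intro i
  refine Fin.addCases (fun j => ?_) (fun j => ?_) i
  · simpa using hx j
  · simpa using hy j

theorem aux_mulVec {a b : ℕ} {s : Set ℝ} (A : Matrix (Fin a) (Fin b) ℝ) {x : ℝ → Fin b → ℝ}
    (hx : ContinuousOn x s) : ContinuousOn (fun t => A *ᵥ x t) s :=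
  (Continuous.matrix_mulVec continuous_const continuous_id).comp_continuousOn hx

theorem aux_deriv {k : ℕ} (P : Matrix (Fin k) (Fin k) ℝ) (hP : P.IsHermitian)
    {y : ℝ → Fin k → ℝ} {y' : Fin k → ℝ} {t : ℝ} (hy : HasDerivAt y y' t) :
    HasDerivAt (fun t => y t ⬝ᵥ P *ᵥ y t) (2 * (y t ⬝ᵥ P *ᵥ y')) t := by
  have h1 := hasDerivAt_pi.1 hy
  have h2 : HasDerivAt (fun t => y t ⬝ᵥ P *ᵥ y t) (y' ⬝ᵥ P *ᵥ y t + y t ⬝ᵥ P *ᵥ y') t := by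
    have h3 : ∀ i, HasDerivAt (fun t => (P *ᵥ y t) i) ((P *ᵥ y') i) t := by
      intro i
      simp only [Matrix.mulVec, dotProduct]
      exact HasDerivAt.fun_sum fun j _ => (h1 j).const_mul _
    simp only [dotProduct, ← Finset.sum_add_distrib]
    exact HasDerivAt.fun_sum fun j _ => (h1 j).mul (h3 j)
  have h4 : y' ⬝ᵥ P *ᵥ y t = y t ⬝ᵥ P *ᵥ y' := by
    have hT : Pᵀ = P := by simpa [Matrix.IsHermitian, Matrix.conjTranspose_eq_transpose_of_trivial] using hP
    rw [Matrix.dotProduct_mulVec, ← Matrix.mulVec_transpose, hT, dotProduct_comm]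
  rw [h4, ← two_mul] at h2
  exact h2

/-- Stability via the zero supply rate: under the dissipation certificate with `s ≡ 0`,
the positive definite function `V` is nonincreasing along trajectories of the uncertain
DAE whose uncertainty satisfies the hard IQC defined by `(Ψ, M)`; thus `V` is a Lyapunov
function certifying stability of the origin. -/
theorem dae_stability_of_certificate
    {n m p l r nψ nz : ℕ}
    (f : (Fin n → ℝ) → (Fin m → ℝ) → (Fin p → ℝ) → (Fin l → ℝ) → (Fin n → ℝ))
    (g : (Fin n → ℝ) → (Fin m → ℝ) → (Fin p → ℝ) → (Fin l → ℝ) → (Fin r → ℝ))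
    (hf : Continuous fun u : ((Fin n → ℝ) × (Fin m → ℝ) × (Fin p → ℝ) × (Fin l → ℝ)) =>
      f u.1 u.2.1 u.2.2.1 u.2.2.2)
    (hg : Continuous fun u : ((Fin n → ℝ) × (Fin m → ℝ) × (Fin p → ℝ) × (Fin l → ℝ)) =>
      g u.1 u.2.1 u.2.2.1 u.2.2.2)
    (AΨ : Matrix (Fin nψ) (Fin nψ) ℝ) (BΨ : Matrix (Fin nψ) (Fin (n + m + l)) ℝ)
    (CΨ : Matrix (Fin nz) (Fin nψ) ℝ) (DΨ : Matrix (Fin nz) (Fin (n + m + l)) ℝ)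
    (M : Matrix (Fin nz) (Fin nz) ℝ) (hM : M.IsSymm)
    (μ lam : ℝ) (hμ : 0 ≤ μ) (hlam : 0 ≤ lam)
    (PΔ : Matrix (Fin nψ) (Fin nψ) ℝ) (hPΔ : PΔ.PosSemidef)
    (V : (Fin n → ℝ) → ℝ) (hV : ContDiff ℝ 1 V) (hV0 : V 0 = 0)
    (hVpos : ∀ x : Fin n → ℝ, x ≠ 0 → 0 < V x)
    (hcert : ∀ (ψ : Fin nψ → ℝ) (x : Fin n → ℝ) (v : Fin m → ℝ) (ξ : Fin l → ℝ)
        (w : Fin p → ℝ),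
      fderiv ℝ V x (f x v w ξ)
          + 2 * (ψ ⬝ᵥ PΔ *ᵥ (AΨ *ᵥ ψ + BΨ *ᵥ Fin.append (Fin.append x v) ξ))
        ≤ lam * (g x v w ξ ⬝ᵥ g x v w ξ)
          + μ * ((CΨ *ᵥ ψ + DΨ *ᵥ Fin.append (Fin.append x v) ξ) ⬝ᵥ
              M *ᵥ (CΨ *ᵥ ψ + DΨ *ᵥ Fin.append (Fin.append x v) ξ)))
    (T : ℝ) (hT : 0 ≤ T)
    (x : ℝ → Fin n → ℝ) (v : ℝ → Fin m → ℝ) (w : ℝ → Fin p → ℝ) (ξ : ℝ → Fin l → ℝ)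
    (ψ : ℝ → Fin nψ → ℝ)
    (hv : ContinuousOn v (Set.Icc 0 T)) (hw : ContinuousOn w (Set.Icc 0 T))
    (hξ : ContinuousOn ξ (Set.Icc 0 T))
    (hx : ∀ t ∈ Set.Icc (0 : ℝ) T, HasDerivAt x (f (x t) (v t) (w t) (ξ t)) t)
    (halg : ∀ t ∈ Set.Icc (0 : ℝ) T, g (x t) (v t) (w t) (ξ t) = 0)
    (hψ0 : ψ 0 = 0)
    (hψ : ∀ t ∈ Set.Icc (0 : ℝ) T,
      HasDerivAt ψ (AΨ *ᵥ ψ t + BΨ *ᵥ Fin.append (Fin.append (x t) (v t)) (ξ t)) t)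
    (hIQC : ∀ T' ∈ Set.Icc (0 : ℝ) T,
      (∫ t in (0 : ℝ)..T',
        (CΨ *ᵥ ψ t + DΨ *ᵥ Fin.append (Fin.append (x t) (v t)) (ξ t)) ⬝ᵥ
          M *ᵥ (CΨ *ᵥ ψ t + DΨ *ᵥ Fin.append (Fin.append (x t) (v t)) (ξ t))) ≤ 0) :
    ∀ T' ∈ Set.Icc (0 : ℝ) T, V (x T') ≤ V (x 0) := by
  intro T' hT'
  have hsub : ∀ t ∈ Set.Icc (0 : ℝ) T', t ∈ Set.Icc (0 : ℝ) T :=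
    fun t ht => ⟨ht.1, ht.2.trans hT'.2⟩
  have hW : ∀ t ∈ Set.Icc (0 : ℝ) T, HasDerivAt (fun t => V (x t) + ψ t ⬝ᵥ PΔ *ᵥ ψ t)
      (fderiv ℝ V (x t) (f (x t) (v t) (w t) (ξ t)) + 2 * (ψ t ⬝ᵥ PΔ *ᵥ
        (AΨ *ᵥ ψ t + BΨ *ᵥ Fin.append (Fin.append (x t) (v t)) (ξ t)))) t := by
    intro t ht
    have hVd : HasFDerivAt V (fderiv ℝ V (x t)) (x t) :=
      (hV.differentiable (by norm_num) (x t)).hasFDerivAt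
    exact (hVd.comp_hasDerivAt t (hx t ht)).add (aux_deriv PΔ hPΔ.1 (hψ t ht))
  have hxc : ContinuousOn x (Set.Icc 0 T) :=
    fun t ht => (hx t ht).continuousAt.continuousWithinAt
  have hψc : ContinuousOn ψ (Set.Icc 0 T) :=
    fun t ht => (hψ t ht).continuousAt.continuousWithinAt
  have hz : ContinuousOn (fun t => CΨ *ᵥ ψ t + DΨ *ᵥ Fin.append (Fin.append (x t) (v t)) (ξ t))
      (Set.Icc 0 T) :=
    (aux_mulVec CΨ hψc).add (aux_mulVec DΨ (aux_append (aux_append hxc hv) hξ))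
  have hq : ContinuousOn (fun t =>
      μ * ((CΨ *ᵥ ψ t + DΨ *ᵥ Fin.append (Fin.append (x t) (v t)) (ξ t)) ⬝ᵥ
          M *ᵥ (CΨ *ᵥ ψ t + DΨ *ᵥ Fin.append (Fin.append (x t) (v t)) (ξ t))))
      (Set.Icc 0 T) := by
    refine continuousOn_const.mul ?_
    exact (Continuous.dotProduct continuous_id
      (Continuous.matrix_mulVec continuous_const continuous_id)).comp_continuousOn hz
  have key := intervalIntegral.sub_le_integral_of_hasDeriv_right_of_le hT'.1
    (fun t ht => (hW t (hsub t ht)).continuousAt.continuousWithinAt)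
    (fun t ht => (hW t (hsub t ⟨ht.1.le, ht.2.le⟩)).hasDerivWithinAt)
    ((hq.mono hsub).integrableOn_Icc)
    (fun t ht => by
      have h := hcert (ψ t) (x t) (v t) (ξ t) (w t)
      rw [halg t (hsub t ⟨ht.1.le, ht.2.le⟩)] at h
      simpa only [dotProduct_zero, mul_zero, zero_add] using h)
  rw [intervalIntegral.integral_const_mul] at key
  have h1 := mul_nonpos_of_nonneg_of_nonpos hμ (hIQC T' hT')
  have h2 : 0 ≤ ψ T' ⬝ᵥ PΔ *ᵥ ψ T' := by
    simpa using hPΔ.dotProduct_mulVec_nonneg (ψ T')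
  simp only [hψ0, zero_dotProduct] at key
  linarith
end

section
/- (L₂-gain bound.) Let γ > 0 and take the supply rate s(w,y) = wᵀw − γ² yᵀy. Suppose there exist scalars μ ≥ 0 and λ ≥ 0, a symmetric positive semidefinite matrix P_Δ, and a continuously differentiable function V : ℝⁿ → ℝ with V(0) = 0 and V(x) > 0 for x ≠ 0, such that for all ψ, x, v, ξ, w: ∇V(x)ᵀ f(x,v,w,ξ) + 2 ψᵀ P_Δ (A_Ψ ψ + B_Ψ (x,v,ξ)) ≤ wᵀw − γ² h(x,v)ᵀh(x,v) + λ ‖g(x,v,w,ξ)‖² + μ (C_Ψ ψ + D_Ψ (x,v,ξ))ᵀ M (C_Ψ ψ + D_Ψ (x,v,ξ)). Then along every trajectory of the DAE on [0,T] starting from x(0) = 0, with associated filter trajectory whose output satisfies the hard IQC defined by (Ψ,M), the output y(t) = h(x(t),v(t)) satisfies γ² ∫₀ᵀ ‖y(t)‖² dt ≤ ∫₀ᵀ ‖w(t)‖² dt. -/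
open Matrix MeasureTheory

lemma aux_dot {k : ℕ} {a b : ℝ → Fin k → ℝ} {a' b' : Fin k → ℝ} {t : ℝ}
    (ha : HasDerivAt a a' t) (hb : HasDerivAt b b' t) :
    HasDerivAt (fun s => a s ⬝ᵥ b s) (a' ⬝ᵥ b t + a t ⬝ᵥ b') t := by
  rw [hasDerivAt_pi] at ha hb
  have := HasDerivAt.fun_sum (u := Finset.univ) (fun i _ => (ha i).mul (hb i))
  simpa [dotProduct, Finset.sum_add_distrib] using this

lemma aux_mulVec_s5 {j k : ℕ} (P : Matrix (Fin j) (Fin k) ℝ) {b : ℝ → Fin k → ℝ}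
    {b' : Fin k → ℝ} {t : ℝ} (hb : HasDerivAt b b' t) :
    HasDerivAt (fun s => P *ᵥ b s) (P *ᵥ b') t := by
  rw [hasDerivAt_pi]
  intro i
  have := aux_dot (hasDerivAt_const t (P i)) hb
  simpa [mulVec] using this

lemma aux_append_s5 {j k : ℕ} {a : ℝ → Fin j → ℝ} {b : ℝ → Fin k → ℝ} {S : Set ℝ}
    (ha : ContinuousOn a S) (hb : ContinuousOn b S) :
    ContinuousOn (fun s => Fin.append (a s) (b s)) S := by
  rw [continuousOn_pi] at *
  intro i
  refine Fin.addCases (fun i => ?_) (fun i => ?_) i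
  · simpa using ha i
  · simpa using hb i

lemma aux_cdot {k : ℕ} {a b : ℝ → Fin k → ℝ} {S : Set ℝ}
    (ha : ContinuousOn a S) (hb : ContinuousOn b S) :
    ContinuousOn (fun s => a s ⬝ᵥ b s) S := by
  rw [continuousOn_pi] at *
  exact continuousOn_finset_sum _ (fun i _ => (ha i).mul (hb i))

lemma aux_cmulVec {j k : ℕ} (P : Matrix (Fin j) (Fin k) ℝ) {b : ℝ → Fin k → ℝ} {S : Set ℝ}
    (hb : ContinuousOn b S) : ContinuousOn (fun s => P *ᵥ b s) S := by
  rw [continuousOn_pi]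
  exact fun i => aux_cdot continuousOn_const hb

/-- L₂-gain bound: under the dissipation certificate with the supply rate
`s(w,y) = wᵀw − γ² yᵀy`, every trajectory of the uncertain DAE starting at the origin,
whose uncertainty satisfies the hard IQC defined by `(Ψ, M)`, satisfies
`γ² ∫₀ᵀ ‖y‖² ≤ ∫₀ᵀ ‖w‖²` for the output `y = h(x,v)`. -/
theorem dae_L2_gain_of_certificate
    {n m p l r q nψ nz : ℕ}
    (f : (Fin n → ℝ) → (Fin m → ℝ) → (Fin p → ℝ) → (Fin l → ℝ) → (Fin n → ℝ))
    (g : (Fin n → ℝ) → (Fin m → ℝ) → (Fin p → ℝ) → (Fin l → ℝ) → (Fin r → ℝ))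
    (h : (Fin n → ℝ) → (Fin m → ℝ) → (Fin q → ℝ))
    (hf : Continuous fun u : ((Fin n → ℝ) × (Fin m → ℝ) × (Fin p → ℝ) × (Fin l → ℝ)) =>
      f u.1 u.2.1 u.2.2.1 u.2.2.2)
    (hg : Continuous fun u : ((Fin n → ℝ) × (Fin m → ℝ) × (Fin p → ℝ) × (Fin l → ℝ)) =>
      g u.1 u.2.1 u.2.2.1 u.2.2.2)
    (hh : Continuous fun u : ((Fin n → ℝ) × (Fin m → ℝ)) => h u.1 u.2)
    (γ : ℝ) (hγ : 0 < γ)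
    (AΨ : Matrix (Fin nψ) (Fin nψ) ℝ) (BΨ : Matrix (Fin nψ) (Fin (n + m + l)) ℝ)
    (CΨ : Matrix (Fin nz) (Fin nψ) ℝ) (DΨ : Matrix (Fin nz) (Fin (n + m + l)) ℝ)
    (M : Matrix (Fin nz) (Fin nz) ℝ) (hM : M.IsSymm)
    (μ lam : ℝ) (hμ : 0 ≤ μ) (hlam : 0 ≤ lam)
    (PΔ : Matrix (Fin nψ) (Fin nψ) ℝ) (hPΔ : PΔ.PosSemidef)
    (V : (Fin n → ℝ) → ℝ) (hV : ContDiff ℝ 1 V) (hV0 : V 0 = 0)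
    (hVpos : ∀ x : Fin n → ℝ, x ≠ 0 → 0 < V x)
    (hcert : ∀ (ψ : Fin nψ → ℝ) (x : Fin n → ℝ) (v : Fin m → ℝ) (ξ : Fin l → ℝ)
        (w : Fin p → ℝ),
      fderiv ℝ V x (f x v w ξ)
          + 2 * (ψ ⬝ᵥ PΔ *ᵥ (AΨ *ᵥ ψ + BΨ *ᵥ Fin.append (Fin.append x v) ξ))
        ≤ w ⬝ᵥ w - γ ^ 2 * (h x v ⬝ᵥ h x v) + lam * (g x v w ξ ⬝ᵥ g x v w ξ)
          + μ * ((CΨ *ᵥ ψ + DΨ *ᵥ Fin.append (Fin.append x v) ξ) ⬝ᵥ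
              M *ᵥ (CΨ *ᵥ ψ + DΨ *ᵥ Fin.append (Fin.append x v) ξ)))
    (T : ℝ) (hT : 0 ≤ T)
    (x : ℝ → Fin n → ℝ) (v : ℝ → Fin m → ℝ) (w : ℝ → Fin p → ℝ) (ξ : ℝ → Fin l → ℝ)
    (ψ : ℝ → Fin nψ → ℝ)
    (hx0 : x 0 = 0)
    (hv : ContinuousOn v (Set.Icc 0 T)) (hw : ContinuousOn w (Set.Icc 0 T))
    (hξ : ContinuousOn ξ (Set.Icc 0 T))
    (hx : ∀ t ∈ Set.Icc (0 : ℝ) T, HasDerivAt x (f (x t) (v t) (w t) (ξ t)) t)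
    (halg : ∀ t ∈ Set.Icc (0 : ℝ) T, g (x t) (v t) (w t) (ξ t) = 0)
    (hψ0 : ψ 0 = 0)
    (hψ : ∀ t ∈ Set.Icc (0 : ℝ) T,
      HasDerivAt ψ (AΨ *ᵥ ψ t + BΨ *ᵥ Fin.append (Fin.append (x t) (v t)) (ξ t)) t)
    (hIQC : ∀ T' ∈ Set.Icc (0 : ℝ) T,
      (∫ t in (0 : ℝ)..T',
        (CΨ *ᵥ ψ t + DΨ *ᵥ Fin.append (Fin.append (x t) (v t)) (ξ t)) ⬝ᵥ
          M *ᵥ (CΨ *ᵥ ψ t + DΨ *ᵥ Fin.append (Fin.append (x t) (v t)) (ξ t))) ≤ 0) :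
    γ ^ 2 * (∫ t in (0 : ℝ)..T, h (x t) (v t) ⬝ᵥ h (x t) (v t))
      ≤ ∫ t in (0 : ℝ)..T, w t ⬝ᵥ w t := by
  have hxc : ContinuousOn x (Set.Icc 0 T) := fun t ht => (hx t ht).continuousAt.continuousWithinAt
  have hψc : ContinuousOn ψ (Set.Icc 0 T) := fun t ht => (hψ t ht).continuousAt.continuousWithinAt
  have hzc := (aux_cmulVec CΨ hψc).add (aux_cmulVec DΨ (aux_append_s5 (aux_append_s5 hxc hv) hξ))
  have hqc := aux_cdot hzc (aux_cmulVec M hzc)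
  have hyc : ContinuousOn (fun t => h (x t) (v t)) (Set.Icc 0 T) :=
    hh.comp_continuousOn (hxc.prodMk hv)
  have hyyc := aux_cdot hyc hyc
  have hwwc := aux_cdot hw hw
  have hqi := hqc.intervalIntegrable_of_Icc (μ := volume) hT
  have hyi := hyyc.intervalIntegrable_of_Icc (μ := volume) hT
  have hwi := hwwc.intervalIntegrable_of_Icc (μ := volume) hT
  have hder : ∀ t ∈ Set.Icc (0 : ℝ) T, HasDerivAt (fun s => V (x s) + ψ s ⬝ᵥ PΔ *ᵥ ψ s)
      (fderiv ℝ V (x t) (f (x t) (v t) (w t) (ξ t)) + 2 * (ψ t ⬝ᵥ PΔ *ᵥ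
        (AΨ *ᵥ ψ t + BΨ *ᵥ Fin.append (Fin.append (x t) (v t)) (ξ t)))) t := by
    intro t ht
    have h1 := ((hV.differentiable one_ne_zero (x t)).hasFDerivAt).comp_hasDerivAt t (hx t ht)
    have h2 := aux_dot (hψ t ht) (aux_mulVec_s5 PΔ (hψ t ht))
    have hs : PΔᵀ = PΔ := by simpa using hPΔ.isHermitian.eq
    have h3 : ∀ a b : Fin nψ → ℝ, a ⬝ᵥ PΔ *ᵥ b = b ⬝ᵥ PΔ *ᵥ a := by
      intro a b
      rw [dotProduct_mulVec, dotProduct_comm, ← mulVec_transpose, hs]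
    rw [h3 _ (ψ t), ← two_mul] at h2
    exact h1.add h2
  have key := intervalIntegral.sub_le_integral_of_hasDeriv_right_of_le hT
    (fun t ht => (hder t ht).continuousAt.continuousWithinAt)
    (fun t ht => (hder t (Set.Ioo_subset_Icc_self ht)).hasDerivWithinAt)
    ((intervalIntegrable_iff_integrableOn_Icc_of_le hT).1
      ((hwi.sub (hyi.const_mul (γ ^ 2))).add (hqi.const_mul μ)))
    (fun t ht => by
      have := hcert (ψ t) (x t) (v t) (ξ t) (w t)
      rw [halg t (Set.Ioo_subset_Icc_self ht)] at this
      simpa using this)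
  have e : ∀ a b c : ℝ → ℝ, IntervalIntegrable a volume 0 T → IntervalIntegrable b volume 0 T →
      IntervalIntegrable c volume 0 T → ∫ t in (0:ℝ)..T, (a t - γ ^ 2 * b t + μ * c t) =
      (∫ t in (0:ℝ)..T, a t) - γ ^ 2 * (∫ t in (0:ℝ)..T, b t) + μ * ∫ t in (0:ℝ)..T, c t := by
    intro a b c ha hb hc
    rw [intervalIntegral.integral_add (ha.sub (hb.const_mul _)) (hc.const_mul _),
      intervalIntegral.integral_sub ha (hb.const_mul _), intervalIntegral.integral_const_mul,
      intervalIntegral.integral_const_mul]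
  have e' := e _ _ _ hwi hyi hqi
  have key' := key.trans_eq e'
  have hq := mul_nonpos_of_nonneg_of_nonpos hμ (hIQC T ⟨hT, le_rfl⟩)
  have hP : 0 ≤ ψ T ⬝ᵥ PΔ *ᵥ ψ T := by simpa using hPΔ.dotProduct_mulVec_nonneg (ψ T)
  have hVT : 0 ≤ V (x T) := by
    by_cases h0 : x T = 0
    · rw [h0, hV0]
    · exact (hVpos _ h0).le
  simp only [hx0, hV0, hψ0, zero_dotProduct, Pi.add_apply] at key'
  linarith
end

section
/- (Proposition 1.) Suppose there exist scalars λ ≥ 0 and μ ≥ 0, a symmetric positive definite matrix P ∈ ℝ^{n×n}, and a symmetric positive semidefinite matrix P_Δ ∈ ℝ^{n_ψ×n_ψ} satisfying the linear matrix inequality: the block matrix [[X(P), P B_w, B_Ψᵀ P_Δ],[B_wᵀ P, 0, 0],[P_Δ B_Ψ, 0, A_Ψᵀ P_Δ + P_Δ A_Ψ]] ⪯ λ [F G_v G_ξ G_w 0]ᵀ [F G_v G_ξ G_w 0] + μ [[D_Ψᵀ M D_Ψ, 0, D_Ψᵀ M C_Ψ],[0,0,0],[C_Ψᵀ M D_Ψ,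 0, C_Ψᵀ M C_Ψ]], where X(P) = [[AᵀP + PA, P B_v, P B_ξ],[B_vᵀP, 0, 0],[B_ξᵀP, 0, 0]] and the block structure conforms to the variable ordering (x, v, ξ, w, ψ). Then for every trajectory (x,v,w,ξ) of the linear DAE on [0,T] with associated filter trajectory whose output satisfies the hard IQC defined by (Ψ,M), the quadratic storage function V(x) = xᵀPx satisfies x(T)ᵀ P x(T) − x(0)ᵀ P x(0) ≤ ∫₀ᵀ s(w(t), x(t)) dt. -/
open Matrix MeasureTheory

theorem aux_symm {k : ℕ} (Q : Matrix (Fin k) (Fin k) ℝ) (hQ : Qᵀ = Q) (a b : Fin k → ℝ) :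
    a ⬝ᵥ Q *ᵥ b = b ⬝ᵥ Q *ᵥ a := by
  conv_rhs => rw [← hQ]
  rw [Matrix.mulVec_transpose, dotProduct_comm b, Matrix.dotProduct_mulVec]

theorem aux_lyap {k : ℕ} (A Q : Matrix (Fin k) (Fin k) ℝ) (hQ : Qᵀ = Q) (a : Fin k → ℝ) :
    a ⬝ᵥ (Aᵀ * Q + Q * A) *ᵥ a = 2 * (a ⬝ᵥ Q *ᵥ (A *ᵥ a)) := by
  have h : a ⬝ᵥ (Aᵀ * Q) *ᵥ a = a ⬝ᵥ Q *ᵥ (A *ᵥ a) := by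
    rw [aux_symm Q hQ a, ← Matrix.mulVec_mulVec, Matrix.mulVec_transpose, dotProduct_comm a,
      ← Matrix.dotProduct_mulVec, dotProduct_comm]
  rw [Matrix.add_mulVec, dotProduct_add, h, ← Matrix.mulVec_mulVec]
  ring

theorem aux_deriv_s7 {k : ℕ} (Q : Matrix (Fin k) (Fin k) ℝ) (hQ : Qᵀ = Q) (x : ℝ → Fin k → ℝ)
    (x' : Fin k → ℝ) (t : ℝ) (h : HasDerivAt x x' t) :
    HasDerivAt (fun t => x t ⬝ᵥ Q *ᵥ x t) (2 * (x t ⬝ᵥ Q *ᵥ x')) t := by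
  have hi := hasDerivAt_pi.1 h
  have h2 : ∀ i, HasDerivAt (fun t => (Q *ᵥ x t) i) ((Q *ᵥ x') i) t := by
    intro i
    simp only [Matrix.mulVec, dotProduct]
    exact HasDerivAt.fun_sum fun j _ => (hi j).const_mul (Q i j)
  have h3 : HasDerivAt (fun t => x t ⬝ᵥ Q *ᵥ x t)
      (∑ i, (x' i * (Q *ᵥ x t) i + x t i * (Q *ᵥ x') i)) t := by
    simp only [dotProduct]
    exact HasDerivAt.fun_sum fun j _ => (hi j).mul (h2 j)
  convert h3 using 1
  rw [Finset.sum_add_distrib]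
  change _ = x' ⬝ᵥ Q *ᵥ x t + x t ⬝ᵥ Q *ᵥ x'
  rw [aux_symm Q hQ x']
  ring

theorem aux_mv {k q : ℕ} (Q : Matrix (Fin k) (Fin q) ℝ) {s : Set ℝ} {f : ℝ → Fin q → ℝ}
    (hf : ContinuousOn f s) : ContinuousOn (fun t => Q *ᵥ f t) s :=
  (Continuous.matrix_mulVec continuous_const continuous_id).comp_continuousOn hf

theorem aux_dot_s7 {k : ℕ} {s : Set ℝ} {f g : ℝ → Fin k → ℝ}
    (hf : ContinuousOn f s) (hg : ContinuousOn g s) : ContinuousOn (fun t => f t ⬝ᵥ g t) s := by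
  simp only [dotProduct]
  exact continuousOn_finsetSum _ fun i _ =>
    (continuousOn_pi.1 hf i).mul (continuousOn_pi.1 hg i)

theorem aux_app {k q : ℕ} {s : Set ℝ} {f : ℝ → Fin k → ℝ} {g : ℝ → Fin q → ℝ}
    (hf : ContinuousOn f s) (hg : ContinuousOn g s) :
    ContinuousOn (fun t => Fin.append (f t) (g t)) s := by
  refine continuousOn_pi.2 fun i => ?_
  refine Fin.addCases (fun j => ?_) (fun j => ?_) i
  · simpa using continuousOn_pi.1 hf j
  · simpa using continuousOn_pi.1 hg j

/-- Proposition 1: feasibility of the LMI (stated equivalently as the inequality of the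
corresponding quadratic forms in the stacked variable `(x, v, ξ, w, ψ)`, including the
supply-rate blocks on the right-hand side) implies dissipativity of the uncertain linear
DAE, with quadratic storage function `V(x) = xᵀ P x`, for every uncertainty satisfying
the hard IQC defined by `(Ψ, M)`. -/
theorem linear_dae_dissipativity_of_LMI
    {n m p l r nψ nz : ℕ}
    (A : Matrix (Fin n) (Fin n) ℝ) (Bv : Matrix (Fin n) (Fin m) ℝ)
    (Bw : Matrix (Fin n) (Fin p) ℝ) (Bξ : Matrix (Fin n) (Fin l) ℝ)
    (F : Matrix (Fin r) (Fin n) ℝ) (Gv : Matrix (Fin r) (Fin m) ℝ)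
    (Gw : Matrix (Fin r) (Fin p) ℝ) (Gξ : Matrix (Fin r) (Fin l) ℝ)
    (Xxx : Matrix (Fin n) (Fin n) ℝ) (Xxw : Matrix (Fin n) (Fin p) ℝ)
    (Xww : Matrix (Fin p) (Fin p) ℝ) (hXxx : Xxx.IsSymm) (hXww : Xww.IsSymm)
    (AΨ : Matrix (Fin nψ) (Fin nψ) ℝ) (BΨ : Matrix (Fin nψ) (Fin (n + m + l)) ℝ)
    (CΨ : Matrix (Fin nz) (Fin nψ) ℝ) (DΨ : Matrix (Fin nz) (Fin (n + m + l)) ℝ)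
    (M : Matrix (Fin nz) (Fin nz) ℝ) (hM : M.IsSymm)
    (lam μ : ℝ) (hlam : 0 ≤ lam) (hμ : 0 ≤ μ)
    (P : Matrix (Fin n) (Fin n) ℝ) (hP : P.PosDef)
    (PΔ : Matrix (Fin nψ) (Fin nψ) ℝ) (hPΔ : PΔ.PosSemidef)
    (hLMI : ∀ (x : Fin n → ℝ) (v : Fin m → ℝ) (ξ : Fin l → ℝ) (w : Fin p → ℝ)
        (ψ : Fin nψ → ℝ),
      x ⬝ᵥ (Aᵀ * P + P * A) *ᵥ x + 2 * (x ⬝ᵥ P *ᵥ (Bv *ᵥ v))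
          + 2 * (x ⬝ᵥ P *ᵥ (Bξ *ᵥ ξ)) + 2 * (x ⬝ᵥ P *ᵥ (Bw *ᵥ w))
          + 2 * (ψ ⬝ᵥ PΔ *ᵥ (BΨ *ᵥ Fin.append (Fin.append x v) ξ))
          + ψ ⬝ᵥ (AΨᵀ * PΔ + PΔ * AΨ) *ᵥ ψ
        ≤ x ⬝ᵥ Xxx *ᵥ x + 2 * (x ⬝ᵥ Xxw *ᵥ w) + w ⬝ᵥ Xww *ᵥ w
          + lam * ((F *ᵥ x + Gv *ᵥ v + Gξ *ᵥ ξ + Gw *ᵥ w) ⬝ᵥ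
              (F *ᵥ x + Gv *ᵥ v + Gξ *ᵥ ξ + Gw *ᵥ w))
          + μ * ((CΨ *ᵥ ψ + DΨ *ᵥ Fin.append (Fin.append x v) ξ) ⬝ᵥ
              M *ᵥ (CΨ *ᵥ ψ + DΨ *ᵥ Fin.append (Fin.append x v) ξ)))
    (T : ℝ) (hT : 0 ≤ T)
    (x : ℝ → Fin n → ℝ) (v : ℝ → Fin m → ℝ) (w : ℝ → Fin p → ℝ) (ξ : ℝ → Fin l → ℝ)
    (ψ : ℝ → Fin nψ → ℝ)
    (hv : ContinuousOn v (Set.Icc 0 T)) (hw : ContinuousOn w (Set.Icc 0 T))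
    (hξ : ContinuousOn ξ (Set.Icc 0 T))
    (hx : ∀ t ∈ Set.Icc (0 : ℝ) T,
      HasDerivAt x (A *ᵥ x t + Bv *ᵥ v t + Bw *ᵥ w t + Bξ *ᵥ ξ t) t)
    (halg : ∀ t ∈ Set.Icc (0 : ℝ) T,
      F *ᵥ x t + Gv *ᵥ v t + Gw *ᵥ w t + Gξ *ᵥ ξ t = 0)
    (hψ0 : ψ 0 = 0)
    (hψ : ∀ t ∈ Set.Icc (0 : ℝ) T,
      HasDerivAt ψ (AΨ *ᵥ ψ t + BΨ *ᵥ Fin.append (Fin.append (x t) (v t)) (ξ t)) t)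
    (hIQC : ∀ T' ∈ Set.Icc (0 : ℝ) T,
      (∫ t in (0 : ℝ)..T',
        (CΨ *ᵥ ψ t + DΨ *ᵥ Fin.append (Fin.append (x t) (v t)) (ξ t)) ⬝ᵥ
          M *ᵥ (CΨ *ᵥ ψ t + DΨ *ᵥ Fin.append (Fin.append (x t) (v t)) (ξ t))) ≤ 0) :
    x T ⬝ᵥ P *ᵥ x T - x 0 ⬝ᵥ P *ᵥ x 0
      ≤ ∫ t in (0 : ℝ)..T,
          (x t ⬝ᵥ Xxx *ᵥ x t + 2 * (x t ⬝ᵥ Xxw *ᵥ w t) + w t ⬝ᵥ Xww *ᵥ w t) := by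
  have hPs : Pᵀ = P := by simpa using hP.isHermitian.eq
  have hQs : PΔᵀ = PΔ := by simpa using hPΔ.isHermitian.eq
  have cx : ContinuousOn x (Set.Icc 0 T) := fun t ht => (hx t ht).continuousAt.continuousWithinAt
  have cψ : ContinuousOn ψ (Set.Icc 0 T) := fun t ht => (hψ t ht).continuousAt.continuousWithinAt
  have cz : ContinuousOn
      (fun t => CΨ *ᵥ ψ t + DΨ *ᵥ Fin.append (Fin.append (x t) (v t)) (ξ t)) (Set.Icc 0 T) :=
    (aux_mv CΨ cψ).add (aux_mv DΨ (aux_app (aux_app cx hv) hξ))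
  have cq := aux_dot_s7 cz (aux_mv M cz)
  have cs : ContinuousOn (fun t => x t ⬝ᵥ Xxx *ᵥ x t + 2 * (x t ⬝ᵥ Xxw *ᵥ w t)
      + w t ⬝ᵥ Xww *ᵥ w t) (Set.Icc 0 T) :=
    ((aux_dot_s7 cx (aux_mv Xxx cx)).add (continuousOn_const.mul (aux_dot_s7 cx (aux_mv Xxw hw)))).add
      (aux_dot_s7 hw (aux_mv Xww hw))
  have hd := fun t ht => (aux_deriv_s7 P hPs x _ t (hx t ht)).add (aux_deriv_s7 PΔ hQs ψ _ t (hψ t ht))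
  have key := intervalIntegral.sub_le_integral_of_hasDeriv_right_of_le hT
    (fun t ht => (hd t ht).continuousAt.continuousWithinAt)
    (fun t ht => (hd t (Set.Ioo_subset_Icc_self ht)).hasDerivWithinAt)
    (cs.add (continuousOn_const (c := μ) |>.mul cq)).integrableOn_Icc
    (fun t ht => by
      have ht' := Set.Ioo_subset_Icc_self ht
      have h1 := hLMI (x t) (v t) (ξ t) (w t) (ψ t)
      have h0 : F *ᵥ x t + Gv *ᵥ v t + Gξ *ᵥ ξ t + Gw *ᵥ w t = 0 := by
        rw [← halg t ht']; abel
      rw [h0, aux_lyap A P hPs, aux_lyap AΨ PΔ hQs] at h1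
      simp only [Matrix.mulVec_add, dotProduct_add, dotProduct_zero, mul_zero,
        Pi.add_apply, Pi.mul_apply] at h1 ⊢
      linarith)
  have hu : Set.uIcc 0 T = Set.Icc 0 T := Set.uIcc_of_le hT
  have hsplit := intervalIntegral.integral_add (μ := volume) (a := 0) (b := T)
    (ContinuousOn.intervalIntegrable (hu.symm ▸ cs))
    (ContinuousOn.intervalIntegrable (hu.symm ▸ (continuousOn_const (c := μ) |>.mul cq)))
  have hI := mul_nonpos_of_nonneg_of_nonpos hμ (hIQC T ⟨hT, le_refl T⟩)
  have hpos : 0 ≤ ψ T ⬝ᵥ PΔ *ᵥ ψ T := by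
    simpa using hPΔ.dotProduct_mulVec_nonneg (ψ T)
  rw [← intervalIntegral.integral_const_mul] at hI
  simp only [Pi.add_apply, Pi.mul_apply, hψ0, zero_dotProduct] at key hsplit
  have key2 := key.trans_eq hsplit
  linarith
end

section
/- (Pointwise-constraint LMI.) Suppose there exist scalars λ ≥ 0 and τ ≥ 0 and a symmetric positive definite matrix P ∈ ℝ^{n×n} such that, in the variable ordering (x, v, ξ, w), [[AᵀP + PA, P B_v, P B_ξ, P B_w],[B_vᵀP,0,0,0],[B_ξᵀP,0,0,0],[B_wᵀP,0,0,0]] ⪯ τ [[M, 0],[0, 0]] + [[X_xx,0,0,X_xw],[0,0,0,0],[0,0,0,0],[X_xwᵀ,0,0,X_ww]] + λ [F G_v G_ξ G_w]ᵀ [F G_v G_ξ G_w], where [[M,0],[0,0]] places the symmetric matrix M on the (x,v,ξ) block. Then for every trajectory (x,v,w,ξ) of the linear DAE on [0,T] satisfying the pointwise quadratic constraint (x(t),v(t),ξ(t))ᵀ M (x(t),v(t),ξ(t)) ≤ 0 for all t ∈ [0,T], it holds that x(T)ᵀ P x(T) − x(0)ᵀ P x(0) ≤ ∫₀ᵀ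 s(w(t), x(t)) dt. -/
open Matrix MeasureTheory

/-- Pointwise-constraint LMI: feasibility of the LMI (stated equivalently as the inequality
of the corresponding quadratic forms in the stacked variable `(x, v, ξ, w)`, where `M` acts
on the `(x, v, ξ)` block) implies dissipativity of the uncertain linear DAE, with quadratic
storage function `V(x) = xᵀ P x`, whenever the uncertainty satisfies the pointwise quadratic
constraint defined by `M`. -/
theorem linear_dae_dissipativity_of_pointwise_LMI
    {n m p l r : ℕ}
    (A : Matrix (Fin n) (Fin n) ℝ) (Bv : Matrix (Fin n) (Fin m) ℝ)
    (Bw : Matrix (Fin n) (Fin p) ℝ) (Bξ : Matrix (Fin n) (Fin l) ℝ)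
    (F : Matrix (Fin r) (Fin n) ℝ) (Gv : Matrix (Fin r) (Fin m) ℝ)
    (Gw : Matrix (Fin r) (Fin p) ℝ) (Gξ : Matrix (Fin r) (Fin l) ℝ)
    (Xxx : Matrix (Fin n) (Fin n) ℝ) (Xxw : Matrix (Fin n) (Fin p) ℝ)
    (Xww : Matrix (Fin p) (Fin p) ℝ) (hXxx : Xxx.IsSymm) (hXww : Xww.IsSymm)
    (M : Matrix (Fin (n + m + l)) (Fin (n + m + l)) ℝ) (hM : M.IsSymm)
    (lam τ : ℝ) (hlam : 0 ≤ lam) (hτ : 0 ≤ τ)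
    (P : Matrix (Fin n) (Fin n) ℝ) (hP : P.PosDef)
    (hLMI : ∀ (x : Fin n → ℝ) (v : Fin m → ℝ) (ξ : Fin l → ℝ) (w : Fin p → ℝ),
      x ⬝ᵥ (Aᵀ * P + P * A) *ᵥ x + 2 * (x ⬝ᵥ P *ᵥ (Bv *ᵥ v))
          + 2 * (x ⬝ᵥ P *ᵥ (Bξ *ᵥ ξ)) + 2 * (x ⬝ᵥ P *ᵥ (Bw *ᵥ w))
        ≤ τ * (Fin.append (Fin.append x v) ξ ⬝ᵥ M *ᵥ Fin.append (Fin.append x v) ξ)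
          + x ⬝ᵥ Xxx *ᵥ x + 2 * (x ⬝ᵥ Xxw *ᵥ w) + w ⬝ᵥ Xww *ᵥ w
          + lam * ((F *ᵥ x + Gv *ᵥ v + Gξ *ᵥ ξ + Gw *ᵥ w) ⬝ᵥ
              (F *ᵥ x + Gv *ᵥ v + Gξ *ᵥ ξ + Gw *ᵥ w)))
    (T : ℝ) (hT : 0 ≤ T)
    (x : ℝ → Fin n → ℝ) (v : ℝ → Fin m → ℝ) (w : ℝ → Fin p → ℝ) (ξ : ℝ → Fin l → ℝ)
    (hv : ContinuousOn v (Set.Icc 0 T)) (hw : ContinuousOn w (Set.Icc 0 T))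
    (hξ : ContinuousOn ξ (Set.Icc 0 T))
    (hx : ∀ t ∈ Set.Icc (0 : ℝ) T,
      HasDerivAt x (A *ᵥ x t + Bv *ᵥ v t + Bw *ᵥ w t + Bξ *ᵥ ξ t) t)
    (halg : ∀ t ∈ Set.Icc (0 : ℝ) T,
      F *ᵥ x t + Gv *ᵥ v t + Gw *ᵥ w t + Gξ *ᵥ ξ t = 0)
    (hQC : ∀ t ∈ Set.Icc (0 : ℝ) T,
      Fin.append (Fin.append (x t) (v t)) (ξ t) ⬝ᵥ
        M *ᵥ Fin.append (Fin.append (x t) (v t)) (ξ t) ≤ 0) :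
    x T ⬝ᵥ P *ᵥ x T - x 0 ⬝ᵥ P *ᵥ x 0
      ≤ ∫ t in (0 : ℝ)..T,
          (x t ⬝ᵥ Xxx *ᵥ x t + 2 * (x t ⬝ᵥ Xxw *ᵥ w t) + w t ⬝ᵥ Xww *ᵥ w t) := by
  have hPs : Pᵀ = P := by
    have := hP.1
    rwa [Matrix.IsHermitian, Matrix.conjTranspose_eq_transpose_of_trivial] at this
  have hxc : ContinuousOn x (Set.Icc 0 T) := fun t ht => (hx t ht).continuousAt.continuousWithinAt
  have hd : ∀ t ∈ Set.Icc (0 : ℝ) T, HasDerivAt (fun t => x t ⬝ᵥ P *ᵥ x t)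
      ((A *ᵥ x t + Bv *ᵥ v t + Bw *ᵥ w t + Bξ *ᵥ ξ t) ⬝ᵥ P *ᵥ x t
        + x t ⬝ᵥ P *ᵥ (A *ᵥ x t + Bv *ᵥ v t + Bw *ᵥ w t + Bξ *ᵥ ξ t)) t := by
    intro t ht
    have h1 := hasDerivAt_pi.1 (hx t ht)
    generalize A *ᵥ x t + Bv *ᵥ v t + Bw *ᵥ w t + Bξ *ᵥ ξ t = y at h1
    simp only [dotProduct, mulVec, ← Finset.sum_add_distrib]
    exact HasDerivAt.fun_sum fun i _ => (h1 i).mul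
      (HasDerivAt.fun_sum fun j _ => (h1 j).const_mul (P i j))
  have hsw : ∀ a b : Fin n → ℝ, a ⬝ᵥ P *ᵥ b = b ⬝ᵥ P *ᵥ a := by
    intro a b
    rw [dotProduct_mulVec, ← mulVec_transpose, hPs, dotProduct_comm]
  have hcq : ∀ {a b : ℕ} (Q : Matrix (Fin a) (Fin b) ℝ) (f : ℝ → Fin a → ℝ) (g : ℝ → Fin b → ℝ),
      ContinuousOn f (Set.Icc 0 T) → ContinuousOn g (Set.Icc 0 T) →
      ContinuousOn (fun t => f t ⬝ᵥ Q *ᵥ g t) (Set.Icc 0 T) := by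
    intro a b Q f g hf hg
    have hf' := continuousOn_pi.1 hf
    have hg' := continuousOn_pi.1 hg
    simp only [dotProduct, mulVec]
    exact continuousOn_finsetSum _ fun i _ => (hf' i).mul
      (continuousOn_finsetSum _ fun j _ => (hg' j).const_mul _)
  refine intervalIntegral.sub_le_integral_of_hasDeriv_right_of_le hT
    (hcq P x x hxc hxc)
    (fun t ht => (hd t (Set.Ioo_subset_Icc_self ht)).hasDerivWithinAt)
    ((((hcq Xxx x x hxc hxc).add ((hcq Xxw x w hxc hw).const_mul 2)).add
      (hcq Xww w w hw hw)).integrableOn_Icc) ?_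
  intro t ht'
  have ht := Set.Ioo_subset_Icc_self ht'
  have h := hLMI (x t) (v t) (ξ t) (w t)
  have ha : F *ᵥ x t + Gv *ᵥ v t + Gξ *ᵥ ξ t + Gw *ᵥ w t = 0 := by
    rw [← halg t ht]; abel
  have hq := mul_nonpos_of_nonneg_of_nonpos hτ (hQC t ht)
  have e : x t ⬝ᵥ (Aᵀ * P + P * A) *ᵥ x t = 2 * (x t ⬝ᵥ P *ᵥ (A *ᵥ x t)) := by
    rw [add_mulVec, dotProduct_add, ← mulVec_mulVec, ← mulVec_mulVec,
      dotProduct_mulVec (x t) Aᵀ, vecMul_transpose, hsw (A *ᵥ x t)]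
    ring
  rw [ha, e, zero_dotProduct, mul_zero, add_zero] at h
  rw [hsw _ (x t)]
  simp only [mulVec_add, dotProduct_add]
  linarith
end

section
/- (Proposition 2, sufficiency.) Consider the linear DAE without uncertainty (ξ ≡ 0). Suppose there exist a scalar λ ≥ 0 and a symmetric positive definite matrix P ∈ ℝ^{n×n} such that, in the variable ordering (x, v, w), [[AᵀP + PA, P B_v, P B_w],[B_vᵀP,0,0],[B_wᵀP,0,0]] ⪯ [[X_xx,0,X_xw],[0,0,0],[X_xwᵀ,0,X_ww]] + λ [F G_v G_w]ᵀ [F G_v G_w]. Then the system is dissipative with storage function V(x) = xᵀPx: along every trajectory (x,v,w) of the linear DAE with ξ ≡ 0 on [0,T], x(T)ᵀ P x(T) − x(0)ᵀ P x(0) ≤ ∫₀ᵀ s(w(t), x(t)) dt. -/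
open Matrix MeasureTheory

theorem aux_contOn_form {a b : ℕ} (M : Matrix (Fin a) (Fin b) ℝ) (f : ℝ → Fin a → ℝ)
    (g : ℝ → Fin b → ℝ) (s : Set ℝ) (hf : ContinuousOn f s) (hg : ContinuousOn g s) :
    ContinuousOn (fun t => f t ⬝ᵥ M *ᵥ g t) s := by
  have hf' := continuousOn_pi.1 hf
  have hg' := continuousOn_pi.1 hg
  simp only [dotProduct, mulVec]
  exact continuousOn_finsetSum _ fun i _ => (hf' i).mul
    (continuousOn_finsetSum _ fun j _ => continuousOn_const.mul (hg' j))

theorem aux_deriv_form {a : ℕ} (P : Matrix (Fin a) (Fin a) ℝ) (f : ℝ → Fin a → ℝ)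
    (f' : Fin a → ℝ) (t : ℝ) (hf : HasDerivAt f f' t) :
    HasDerivAt (fun t => f t ⬝ᵥ P *ᵥ f t) (f' ⬝ᵥ P *ᵥ f t + f t ⬝ᵥ P *ᵥ f') t := by
  have hf' := hasDerivAt_pi.1 hf
  simp only [dotProduct, mulVec]
  rw [← Finset.sum_add_distrib]
  exact HasDerivAt.fun_sum fun i _ => (hf' i).mul
    (HasDerivAt.fun_sum fun j _ => (hf' j).const_mul (P i j))

/-- Proposition 2 (sufficiency): for the linear DAE without uncertainty, feasibility of the
LMI (stated equivalently as the inequality of the corresponding quadratic forms in the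
stacked variable `(x, v, w)`) implies dissipativity with quadratic storage function
`V(x) = xᵀ P x`. -/
theorem linear_dae_dissipativity_of_LMI_no_uncertainty
    {n m p r : ℕ}
    (A : Matrix (Fin n) (Fin n) ℝ) (Bv : Matrix (Fin n) (Fin m) ℝ)
    (Bw : Matrix (Fin n) (Fin p) ℝ)
    (F : Matrix (Fin r) (Fin n) ℝ) (Gv : Matrix (Fin r) (Fin m) ℝ)
    (Gw : Matrix (Fin r) (Fin p) ℝ)
    (Xxx : Matrix (Fin n) (Fin n) ℝ) (Xxw : Matrix (Fin n) (Fin p) ℝ)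
    (Xww : Matrix (Fin p) (Fin p) ℝ) (hXxx : Xxx.IsSymm) (hXww : Xww.IsSymm)
    (lam : ℝ) (hlam : 0 ≤ lam)
    (P : Matrix (Fin n) (Fin n) ℝ) (hP : P.PosDef)
    (hLMI : ∀ (x : Fin n → ℝ) (v : Fin m → ℝ) (w : Fin p → ℝ),
      x ⬝ᵥ (Aᵀ * P + P * A) *ᵥ x + 2 * (x ⬝ᵥ P *ᵥ (Bv *ᵥ v)) + 2 * (x ⬝ᵥ P *ᵥ (Bw *ᵥ w))
        ≤ x ⬝ᵥ Xxx *ᵥ x + 2 * (x ⬝ᵥ Xxw *ᵥ w) + w ⬝ᵥ Xww *ᵥ w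
          + lam * ((F *ᵥ x + Gv *ᵥ v + Gw *ᵥ w) ⬝ᵥ (F *ᵥ x + Gv *ᵥ v + Gw *ᵥ w)))
    (T : ℝ) (hT : 0 ≤ T)
    (x : ℝ → Fin n → ℝ) (v : ℝ → Fin m → ℝ) (w : ℝ → Fin p → ℝ)
    (hv : ContinuousOn v (Set.Icc 0 T)) (hw : ContinuousOn w (Set.Icc 0 T))
    (hx : ∀ t ∈ Set.Icc (0 : ℝ) T,
      HasDerivAt x (A *ᵥ x t + Bv *ᵥ v t + Bw *ᵥ w t) t)
    (halg : ∀ t ∈ Set.Icc (0 : ℝ) T, F *ᵥ x t + Gv *ᵥ v t + Gw *ᵥ w t = 0) :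
    x T ⬝ᵥ P *ᵥ x T - x 0 ⬝ᵥ P *ᵥ x 0
      ≤ ∫ t in (0 : ℝ)..T,
          (x t ⬝ᵥ Xxx *ᵥ x t + 2 * (x t ⬝ᵥ Xxw *ᵥ w t) + w t ⬝ᵥ Xww *ᵥ w t) := by
  have hxc : ContinuousOn x (Set.Icc 0 T) := fun t ht => (hx t ht).continuousAt.continuousWithinAt
  have hsym : Pᵀ = P := by
    have h := hP.isHermitian.eq
    rwa [conjTranspose_eq_transpose_of_trivial] at h
  have hcomm : ∀ y z : Fin n → ℝ, y ⬝ᵥ P *ᵥ z = z ⬝ᵥ P *ᵥ y := by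
    intro y z
    rw [dotProduct_mulVec, ← mulVec_transpose, hsym, dotProduct_comm]
  have hsc : ContinuousOn (fun t => x t ⬝ᵥ Xxx *ᵥ x t + 2 * (x t ⬝ᵥ Xxw *ᵥ w t)
      + w t ⬝ᵥ Xww *ᵥ w t) (Set.Icc 0 T) :=
    ((aux_contOn_form Xxx x x _ hxc hxc).add
      (continuousOn_const.mul (aux_contOn_form Xxw x w _ hxc hw))).add
      (aux_contOn_form Xww w w _ hw hw)
  refine intervalIntegral.sub_le_integral_of_hasDeriv_right_of_le (g := fun t => x t ⬝ᵥ P *ᵥ x t) hT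
    (aux_contOn_form P x x _ hxc hxc)
    (fun t ht => (aux_deriv_form P x _ t (hx t (Set.Ioo_subset_Icc_self ht))).hasDerivWithinAt)
    hsc.integrableOn_Icc ?_
  intro t ht
  have ht' := Set.Ioo_subset_Icc_self ht
  have h := hLMI (x t) (v t) (w t)
  rw [halg t ht'] at h
  have e : x t ⬝ᵥ (Aᵀ * P + P * A) *ᵥ x t = 2 * (x t ⬝ᵥ P *ᵥ (A *ᵥ x t)) := by
    rw [add_mulVec, dotProduct_add, ← mulVec_mulVec, ← mulVec_mulVec,
      dotProduct_mulVec (x t) Aᵀ, vecMul_transpose, hcomm (A *ᵥ x t)]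
    ring
  rw [e] at h
  simp only [dotProduct_zero, mul_zero, add_zero] at h
  rw [hcomm (A *ᵥ x t + Bv *ᵥ v t + Bw *ᵥ w t)]
  simp only [mulVec_add, dotProduct_add]
  linarith
end

section
/- (L₂ gain certificate for a plant in feedback with an implicit neural network controller.) Consider the closed-loop system ẋ(t) = 𝒜 x(t) + ℬ_w w(t) + ℬ_ξ ξ(t), 0 = 𝒞 x(t) − v(t) + 𝒟 ξ(t), ξ(t) = φ(v(t)), y(t) = 𝒞_y x(t), where φ acts elementwise with each component sector bounded in [0,1]. Suppose there exist a symmetric positive definite matrix P, a diagonal matrix Λ with strictly positive diagonal entries, and a scalar λ ≥ 0 such that, in the variable ordering (x, w, v, ξ): [[𝒜ᵀP + P𝒜 + γ² 𝒞_yᵀ𝒞_y, Pℬ_w, 0, Pℬ_ξ],[ℬ_wᵀP, −I, 0, 0],[0,0,0,0],[ℬ_ξᵀP, 0, 0, 0]] ⪯ [[0,0,0,0],[0,0,0,0],[0,0,0,−½Λ],[0,0,−½Λ,Λ]] + λ [𝒞 0 −I 𝒟]ᵀ [𝒞 0 −I 𝒟]. Then along every trajectory of the closed-loop system on [0,T]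 with x(0) = 0, γ² ∫₀ᵀ ‖y(t)‖² dt ≤ ∫₀ᵀ ‖w(t)‖² dt. -/
open Matrix MeasureTheory

/-- L₂-gain certificate for a linear plant in feedback with an implicit neural network
controller: feasibility of the LMI (stated equivalently as the inequality of the
corresponding quadratic forms in the stacked variable `(x, w, v, ξ)`) implies that along
every closed-loop trajectory starting from the origin,
`γ² ∫₀ᵀ ‖y‖² ≤ ∫₀ᵀ ‖w‖²` for the output `y = 𝒞_y x`. -/
theorem implicit_nn_closed_loop_L2_gain
    {n p k q : ℕ}
    (A : Matrix (Fin n) (Fin n) ℝ) (Bw : Matrix (Fin n) (Fin p) ℝ)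
    (Bξ : Matrix (Fin n) (Fin k) ℝ) (C : Matrix (Fin k) (Fin n) ℝ)
    (D : Matrix (Fin k) (Fin k) ℝ) (Cy : Matrix (Fin q) (Fin n) ℝ)
    (γ : ℝ) (hγ : 0 < γ)
    (φ : Fin k → ℝ → ℝ)
    (hsec : ∀ (i : Fin k) (a : ℝ), φ i a * (φ i a - a) ≤ 0)
    (P : Matrix (Fin n) (Fin n) ℝ) (hP : P.PosDef)
    (Λ : Fin k → ℝ) (hΛ : ∀ i, 0 < Λ i)
    (lam : ℝ) (hlam : 0 ≤ lam)
    (hLMI : ∀ (x : Fin n → ℝ) (w : Fin p → ℝ) (v ξ : Fin k → ℝ),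
      x ⬝ᵥ (Aᵀ * P + P * A) *ᵥ x + γ ^ 2 * ((Cy *ᵥ x) ⬝ᵥ (Cy *ᵥ x))
          + 2 * (x ⬝ᵥ P *ᵥ (Bw *ᵥ w)) + 2 * (x ⬝ᵥ P *ᵥ (Bξ *ᵥ ξ)) - w ⬝ᵥ w
        ≤ ξ ⬝ᵥ Matrix.diagonal Λ *ᵥ ξ - v ⬝ᵥ Matrix.diagonal Λ *ᵥ ξ
          + lam * ((C *ᵥ x - v + D *ᵥ ξ) ⬝ᵥ (C *ᵥ x - v + D *ᵥ ξ)))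
    (T : ℝ) (hT : 0 ≤ T)
    (x : ℝ → Fin n → ℝ) (v : ℝ → Fin k → ℝ) (w : ℝ → Fin p → ℝ) (ξ : ℝ → Fin k → ℝ)
    (hx0 : x 0 = 0)
    (hv : ContinuousOn v (Set.Icc 0 T)) (hw : ContinuousOn w (Set.Icc 0 T))
    (hξcont : ContinuousOn ξ (Set.Icc 0 T))
    (hx : ∀ t ∈ Set.Icc (0 : ℝ) T,
      HasDerivAt x (A *ᵥ x t + Bw *ᵥ w t + Bξ *ᵥ ξ t) t)
    (halg : ∀ t ∈ Set.Icc (0 : ℝ) T, C *ᵥ x t - v t + D *ᵥ ξ t = 0)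
    (hξ : ∀ t ∈ Set.Icc (0 : ℝ) T, ∀ i, ξ t i = φ i (v t i)) :
    γ ^ 2 * (∫ t in (0 : ℝ)..T, (Cy *ᵥ x t) ⬝ᵥ (Cy *ᵥ x t))
      ≤ ∫ t in (0 : ℝ)..T, w t ⬝ᵥ w t := by
  have hxc : ContinuousOn x (Set.Icc 0 T) := fun t ht => (hx t ht).continuousAt.continuousWithinAt
  have hmv : ∀ {a b : ℕ} (M : Matrix (Fin a) (Fin b) ℝ) (f : ℝ → Fin b → ℝ),
      ContinuousOn f (Set.Icc 0 T) → ContinuousOn (fun t => M *ᵥ f t) (Set.Icc 0 T) := by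
    intro a b M f hf
    exact (Continuous.matrix_mulVec continuous_const continuous_id).comp_continuousOn hf
  have hdp : ∀ {a : ℕ} (f g : ℝ → Fin a → ℝ), ContinuousOn f (Set.Icc 0 T) →
      ContinuousOn g (Set.Icc 0 T) → ContinuousOn (fun t => f t ⬝ᵥ g t) (Set.Icc 0 T) := by
    intro a f g hf hg
    exact (Continuous.dotProduct continuous_fst continuous_snd).comp_continuousOn (hf.prodMk hg)
  have hdd : ∀ (f g : ℝ → Fin n → ℝ) (f' g' : Fin n → ℝ) (t : ℝ), HasDerivAt f f' t →
      HasDerivAt g g' t → HasDerivAt (fun t => f t ⬝ᵥ g t) (f' ⬝ᵥ g t + f t ⬝ᵥ g') t := by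
    intro f g f' g' t hf hg
    simp only [dotProduct, ← Finset.sum_add_distrib]
    exact HasDerivAt.fun_sum fun i _ => (hasDerivAt_pi.1 hf i).mul (hasDerivAt_pi.1 hg i)
  have hdm : ∀ (f : ℝ → Fin n → ℝ) (f' : Fin n → ℝ) (t : ℝ), HasDerivAt f f' t →
      HasDerivAt (fun t => P *ᵥ f t) (P *ᵥ f') t := by
    intro f f' t hf
    rw [hasDerivAt_pi]
    intro i
    simp only [mulVec, dotProduct]
    exact HasDerivAt.fun_sum fun j _ => (hasDerivAt_pi.1 hf j).const_mul (P i j)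
  have hPt : Pᵀ = P := by
    have := hP.isHermitian.eq
    rwa [conjTranspose_eq_transpose_of_trivial] at this
  have hsym : ∀ a b : Fin n → ℝ, a ⬝ᵥ P *ᵥ b = b ⬝ᵥ P *ᵥ a := by
    intro a b
    rw [dotProduct_mulVec, ← mulVec_transpose, hPt, dotProduct_comm]
  set d : ℝ → Fin n → ℝ := fun t => A *ᵥ x t + Bw *ᵥ w t + Bξ *ᵥ ξ t with hd
  have hdc : ContinuousOn d (Set.Icc 0 T) := ((hmv A x hxc).add (hmv Bw w hw)).add (hmv Bξ ξ hξcont)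
  have hV : ∀ t ∈ Set.Icc (0 : ℝ) T,
      HasDerivAt (fun t => x t ⬝ᵥ P *ᵥ x t) (2 * (x t ⬝ᵥ P *ᵥ d t)) t := by
    intro t ht
    have := hdd x _ _ _ t (hx t ht) (hdm x _ t (hx t ht))
    convert this using 1
    rw [hsym _ (x t)]
    ring
  have hVc : ContinuousOn (fun t => 2 * (x t ⬝ᵥ P *ᵥ d t)) (Set.Icc 0 T) :=
    continuousOn_const.mul (hdp _ _ hxc (hmv P d hdc))
  have hyc := hdp _ _ (hmv Cy x hxc) (hmv Cy x hxc)
  have hwc := hdp _ _ hw hw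
  have hyi := hyc.intervalIntegrable_of_Icc (μ := volume) hT
  have hwi := hwc.intervalIntegrable_of_Icc (μ := volume) hT
  have hVi := hVc.intervalIntegrable_of_Icc (μ := volume) hT
  have hFTC : ∫ t in (0 : ℝ)..T, 2 * (x t ⬝ᵥ P *ᵥ d t) = x T ⬝ᵥ P *ᵥ x T - x 0 ⬝ᵥ P *ᵥ x 0 :=
    intervalIntegral.integral_eq_sub_of_hasDerivAt
      (fun t ht => hV t (by rwa [Set.uIcc_of_le hT] at ht)) hVi
  have hVT : 0 ≤ x T ⬝ᵥ P *ᵥ x T := by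
    simpa using hP.posSemidef.dotProduct_mulVec_nonneg (x T)
  have hpt : ∀ t ∈ Set.Icc (0 : ℝ) T,
      γ ^ 2 * ((Cy *ᵥ x t) ⬝ᵥ (Cy *ᵥ x t)) + 2 * (x t ⬝ᵥ P *ᵥ d t) ≤ w t ⬝ᵥ w t := by
    intro t ht
    have h := hLMI (x t) (w t) (v t) (ξ t)
    rw [halg t ht] at h
    have hs : ξ t ⬝ᵥ Matrix.diagonal Λ *ᵥ ξ t - v t ⬝ᵥ Matrix.diagonal Λ *ᵥ ξ t ≤ 0 := by
      rw [← sub_dotProduct]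
      simp only [dotProduct, mulVec_diagonal]
      apply Finset.sum_nonpos
      intro i _
      have h1 := hsec i (v t i)
      rw [← hξ t ht i] at h1
      have h2 := mul_nonpos_of_nonneg_of_nonpos (hΛ i).le h1
      simp only [Pi.sub_apply]
      linarith
    have hA : x t ⬝ᵥ (Aᵀ * P + P * A) *ᵥ x t = 2 * (x t ⬝ᵥ P *ᵥ (A *ᵥ x t)) := by
      rw [add_mulVec, dotProduct_add, ← mulVec_mulVec, ← mulVec_mulVec, dotProduct_mulVec (x t) Aᵀ,
        vecMul_transpose, hsym (A *ᵥ x t)]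
      ring
    simp only [hd, mulVec_add, dotProduct_add]
    rw [hA] at h
    simp only [dotProduct_zero, mul_zero] at h
    linarith
  have hI := intervalIntegral.integral_mono_on hT ((hyi.const_mul (γ ^ 2)).add hVi) hwi hpt
  rw [intervalIntegral.integral_add (hyi.const_mul (γ ^ 2)) hVi, hFTC,
    intervalIntegral.integral_const_mul, hx0] at hI
  simp only [zero_dotProduct] at hI
  linarith
end

section
/- (Rank-structured parametric uncertainty satisfies the quadratic constraint used for line failures.) Let J ∈ ℝ^{m×k}, let δ ∈ ℝ with |δ| ≤ ½, let v ∈ ℝᵐ, and set ξ = δ Jᵀ v ∈ ℝᵏ. Then for every symmetric positive semidefinite matrix X ∈ ℝ^{k×k} and every skew-symmetric matrix Y ∈ ℝ^{k×k} (Y = −Yᵀ), the quadratic constraint [ξ; v]ᵀ [[X, −½ Y Jᵀ],[−½ J Yᵀ, −¼ J X Jᵀ]] [ξ; v] ≤ 0 holds. -/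
open Matrix

/-- Rank-structured parametric uncertainty `ξ = δ Jᵀ v` with `|δ| ≤ ½` satisfies, for every
symmetric positive semidefinite `X` and skew-symmetric `Y`, the quadratic constraint
`[ξ; v]ᵀ [[X, −½ Y Jᵀ],[−½ J Yᵀ, −¼ J X Jᵀ]] [ξ; v] ≤ 0` used to model power-network line
failures. -/
theorem line_failure_uncertainty_quadratic_constraint
    {m k : ℕ} (J : Matrix (Fin m) (Fin k) ℝ) (δ : ℝ) (hδ : |δ| ≤ 1 / 2)
    (v : Fin m → ℝ)
    (X : Matrix (Fin k) (Fin k) ℝ) (hX : X.PosSemidef)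
    (Y : Matrix (Fin k) (Fin k) ℝ) (hY : Y = -Yᵀ) :
    (Sum.elim (δ • (Jᵀ *ᵥ v)) v) ⬝ᵥ
        (Matrix.fromBlocks X (-(1 / 2 : ℝ) • (Y * Jᵀ)) (-(1 / 2 : ℝ) • (J * Yᵀ))
          (-(1 / 4 : ℝ) • (J * X * Jᵀ))) *ᵥ
        (Sum.elim (δ • (Jᵀ *ᵥ v)) v) ≤ 0 := by
  have hJ : ∀ z : Fin k → ℝ, v ⬝ᵥ (J *ᵥ z) = (Jᵀ *ᵥ v) ⬝ᵥ z := by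
    intro z
    rw [Matrix.dotProduct_mulVec, Matrix.mulVec_transpose]
  have hT : (Jᵀ *ᵥ v) ⬝ᵥ (Yᵀ *ᵥ (Jᵀ *ᵥ v)) = (Jᵀ *ᵥ v) ⬝ᵥ (Y *ᵥ (Jᵀ *ᵥ v)) := by
    generalize Jᵀ *ᵥ v = w
    rw [Matrix.mulVec_transpose, dotProduct_comm, Matrix.dotProduct_mulVec]
  have hY0 : (Jᵀ *ᵥ v) ⬝ᵥ (Y *ᵥ (Jᵀ *ᵥ v)) = 0 := by
    have h : (Jᵀ *ᵥ v) ⬝ᵥ (Y *ᵥ (Jᵀ *ᵥ v)) = -((Jᵀ *ᵥ v) ⬝ᵥ (Yᵀ *ᵥ (Jᵀ *ᵥ v))) := by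
      conv_lhs => rw [hY]
      rw [Matrix.neg_mulVec, dotProduct_neg]
    linarith
  have hX0 : 0 ≤ (Jᵀ *ᵥ v) ⬝ᵥ (X *ᵥ (Jᵀ *ᵥ v)) := by
    simpa using hX.dotProduct_mulVec_nonneg (Jᵀ *ᵥ v)
  have hd : δ ^ 2 ≤ 1 / 4 := by
    have := abs_le.mp hδ
    nlinarith
  rw [Matrix.fromBlocks_mulVec, sumElim_dotProduct_sumElim]
  simp only [Sum.elim_comp_inl, Sum.elim_comp_inr, dotProduct_add, Matrix.smul_mulVec,
    Matrix.mulVec_smul, dotProduct_smul, smul_dotProduct, smul_eq_mul,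
    ← Matrix.mulVec_mulVec, hJ, hT, hY0]
  nlinarith
end
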